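/- For integers k ≥ i ≥ 1 and complex a, q with 0 < |q| < 1 and a such that all Pochhammer symbols appearing are nonzero (e.g. a > 0 real), Σ_{N=0}^{∞} a^N q^{N(N+1)/2} (−1/a;q)_N Σ_{n=−N}^{N} (−1)^n q^{kn² + n(k−i) − n(n−1)/2} / ((q;q)_{N−n} (q;q)_{N+n}) = ((−aq;q)_∞/(q;q)_∞) Σ_{n=−∞}^{∞} (−1)^n a^n q^{kn² + (k−i+1)n} (−1/a;q)_n / (−aq;q)_n. -/

import Mathlib

namespace Paper

open scoped Classical

/-- The infinite q-Pochhammer symbol `(x;q)_∞ = ∏_{i≥0} (1 - x qⁱ)`. -/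
noncomputable def qPochInf (x q : ℂ) : ℂ := ∏' i : ℕ, (1 - x * q ^ i)

/-- The finite q-Pochhammer symbol `(x;q)_N = ∏_{i=0}^{N-1} (1 - x qⁱ)`. -/
noncomputable def qPochN (x q : ℂ) (N : ℕ) : ℂ := ∏ i ∈ Finset.range N, (1 - x * q ^ i)

/-- The q-Pochhammer symbol with arbitrary integer index,
`(x;q)_n = (x;q)_∞ / (x qⁿ;q)_∞`. -/
noncomputable def qPochZ (x q : ℂ) (n : ℤ) : ℂ := qPochInf x q / qPochInf (x * q ^ n) q

open Filter Topology

section InfinitePochhammer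

variable {q : ℂ}

lemma summable_norm_mul_pow (hq1 : ‖q‖ < 1) (x : ℂ) : Summable fun i : ℕ => ‖-(x * q ^ i)‖ := by
  simpa using (summable_geometric_of_lt_one (norm_nonneg q) hq1).mul_left ‖x‖

lemma multipliable_qPochInf (hq1 : ‖q‖ < 1) (x : ℂ) :
    Multipliable fun i : ℕ => 1 - x * q ^ i := by
  simpa [sub_eq_add_neg] using multipliable_one_add_of_summable (summable_norm_mul_pow hq1 x)

lemma qPochInf_eq_mul (hq1 : ‖q‖ < 1) (x : ℂ) :
    qPochInf x q = (1 - x) * qPochInf (x * q) q := by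
  have h := multipliable_qPochInf hq1 (x * q)
  have hfun : (fun i : ℕ => 1 - x * q ^ (i + 1)) = fun i : ℕ => 1 - x * q * q ^ i := by
    funext i; ring
  rw [qPochInf, tprod_eq_zero_mul' (by rw [hfun]; exact h), hfun, qPochInf]
  simp

lemma qPochInf_ne_zero (hq1 : ‖q‖ < 1) {x : ℂ} (hx : ∀ i : ℕ, 1 - x * q ^ i ≠ 0) :
    qPochInf x q ≠ 0 := by
  have := tprod_one_add_ne_zero_of_summable (f := fun i : ℕ => -(x * q ^ i))
    (by simpa [← sub_eq_add_neg] using hx) (summable_norm_mul_pow hq1 x)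
  simpa [qPochInf, sub_eq_add_neg] using this

lemma qPochInf_eq_zero {x : ℂ} (i : ℕ) (hx : 1 - x * q ^ i = 0) : qPochInf x q = 0 :=
  tprod_of_exists_eq_zero ⟨i, hx⟩

lemma norm_qPochInf_sub_one_le (hq1 : ‖q‖ < 1) (x : ℂ) :
    ‖qPochInf x q - 1‖ ≤ Real.exp (‖x‖ * (1 - ‖q‖)⁻¹) - 1 := by
  refine le_of_tendsto (((multipliable_qPochInf hq1 x).hasProd.sub_const 1).norm)
    (Eventually.of_forall fun s => ?_)
  have h := s.norm_prod_one_add_sub_one_le fun i : ℕ => -(x * q ^ i)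
  simp only [← sub_eq_add_neg] at h
  refine h.trans ?_
  gcongr
  refine ((summable_norm_mul_pow hq1 x).sum_le_tsum s fun _ _ => norm_nonneg _).trans_eq ?_
  simp [tsum_mul_left, tsum_geometric_of_lt_one (norm_nonneg q) hq1]

lemma norm_qPochInf_le (hq1 : ‖q‖ < 1) {x : ℂ} {r : ℝ} (hx : ‖x‖ ≤ r) :
    ‖qPochInf x q‖ ≤ Real.exp (r * (1 - ‖q‖)⁻¹) := by
  have h := norm_qPochInf_sub_one_le hq1 x
  have h2 : ‖qPochInf x q‖ ≤ ‖qPochInf x q - 1‖ + 1 := by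
    simpa using norm_add_le (qPochInf x q - 1) 1
  have h3 : 0 ≤ (1 - ‖q‖)⁻¹ := inv_nonneg.2 (by linarith)
  calc ‖qPochInf x q‖ ≤ Real.exp (‖x‖ * (1 - ‖q‖)⁻¹) := by linarith
    _ ≤ _ := by gcongr

lemma tendsto_qPochInf_mul_pow (hq1 : ‖q‖ < 1) (x : ℂ) :
    Tendsto (fun n : ℕ => qPochInf (x * q ^ n) q) atTop (𝓝 1) := by
  rw [tendsto_iff_norm_sub_tendsto_zero]
  refine squeeze_zero (fun _ => norm_nonneg _) (fun n => norm_qPochInf_sub_one_le hq1 _) ?_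
  have h : Tendsto (fun n : ℕ => ‖x * q ^ n‖) atTop (𝓝 0) := by
    simpa using ((tendsto_pow_atTop_nhds_zero_of_norm_lt_one hq1).const_mul x).norm
  simpa using! ((Real.continuous_exp.tendsto _).comp (h.mul_const (1 - ‖q‖)⁻¹)).sub_const 1

lemma one_sub_pow_succ_ne_zero (hq1 : ‖q‖ < 1) (j : ℕ) : 1 - q ^ (j + 1) ≠ 0 := by
  intro h
  have h1 : ‖q ^ (j + 1)‖ = 1 := by rw [← sub_eq_zero.1 h, norm_one]
  rw [norm_pow] at h1
  exact (pow_lt_one₀ (norm_nonneg q) hq1 j.succ_ne_zero).ne h1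

lemma qPochInf_self_ne_zero (hq1 : ‖q‖ < 1) : qPochInf q q ≠ 0 :=
  qPochInf_ne_zero hq1 fun i => by simpa [pow_succ'] using one_sub_pow_succ_ne_zero hq1 i

lemma prod_mul_qPochInf (hq1 : ‖q‖ < 1) (x : ℂ) (n : ℕ) :
    (∏ j ∈ Finset.range n, (1 - x * q ^ j)) * qPochInf (x * q ^ n) q = qPochInf x q := by
  induction n with
  | zero => simp
  | succ n ih =>
    rw [← ih, Finset.prod_range_succ, qPochInf_eq_mul hq1 (x * q ^ n), pow_succ]
    ring_nf

end InfinitePochhammer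

/-- A ratio test: products of a null sequence are summable. -/
lemma summable_prod_range_of_tendsto_zero {𝕜 : Type*} [NormedField 𝕜] [CompleteSpace 𝕜]
    {r : ℕ → 𝕜} (hr : Tendsto r atTop (𝓝 0)) :
    Summable fun M : ℕ => ∏ j ∈ Finset.range M, r j := by
  refine summable_of_ratio_norm_eventually_le (r := 1 / 2) (by norm_num) ?_
  have h := hr.norm
  rw [norm_zero] at h
  filter_upwards [h.eventually_le_const (show (0 : ℝ) < 1 / 2 by norm_num)] with n hn
  rw [Finset.prod_range_succ, norm_mul, mul_comm]
  gcongr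

section ConfluentGauss

variable {q : ℂ}

/-- The term of the `₁φ₁` series in `c` and `t = c / b`, normalised by `(c;q)_∞` so that it is
polynomial in `t` and defined for all `c`. -/
noncomputable def gaussTerm (q c t : ℂ) (M : ℕ) : ℂ :=
  (∏ j ∈ Finset.range M, q ^ j * (c * q ^ j - t) / (1 - q ^ (j + 1))) * qPochInf (c * q ^ M) q

lemma gaussTerm_bound_summable (hq1 : ‖q‖ < 1) (s : ℝ) :
    Summable fun M : ℕ => ∏ j ∈ Finset.range M, ‖q‖ ^ j * s / ‖1 - q ^ (j + 1)‖ := by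
  refine summable_prod_range_of_tendsto_zero ?_
  have h1 := tendsto_pow_atTop_nhds_zero_of_lt_one (norm_nonneg q) hq1
  have h2 : Tendsto (fun j : ℕ => ‖1 - q ^ (j + 1)‖) atTop (𝓝 1) := by
    simpa using (((tendsto_add_atTop_iff_nat 1).2
      (tendsto_pow_atTop_nhds_zero_of_norm_lt_one hq1)).const_sub 1).norm
  simpa using! (h1.mul_const s).div h2 one_ne_zero

lemma norm_gaussTerm_le (hq1 : ‖q‖ < 1) {c t : ℂ} {r s : ℝ} (hc : ‖c‖ ≤ r) (ht : ‖t‖ ≤ s)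
    (M : ℕ) :
    ‖gaussTerm q c t M‖ ≤ (∏ j ∈ Finset.range M, ‖q‖ ^ j * (r + s) / ‖1 - q ^ (j + 1)‖) *
      Real.exp (r * (1 - ‖q‖)⁻¹) := by
  have hpow (j : ℕ) : ‖c * q ^ j‖ ≤ r := by
    rw [norm_mul, norm_pow]
    exact (mul_le_of_le_one_right (norm_nonneg _) (pow_le_one₀ (norm_nonneg _) hq1.le)).trans hc
  have hr : 0 ≤ r := (norm_nonneg c).trans hc
  have hs : 0 ≤ s := (norm_nonneg t).trans ht
  rw [gaussTerm, norm_mul, norm_prod]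
  refine mul_le_mul (Finset.prod_le_prod (fun _ _ => norm_nonneg _) fun j _ => ?_)
    (norm_qPochInf_le hq1 (hpow M)) (norm_nonneg _)
    (Finset.prod_nonneg fun j _ => by positivity)
  rw [norm_div, norm_mul, norm_pow]
  gcongr
  exact (norm_sub_le _ _).trans (add_le_add (hpow j) ht)

lemma summable_gaussTerm (hq1 : ‖q‖ < 1) (c t : ℂ) : Summable (gaussTerm q c t) :=
  Summable.of_norm_bounded ((gaussTerm_bound_summable hq1 (‖c‖ + ‖t‖)).mul_right _)
    (norm_gaussTerm_le hq1 le_rfl le_rfl)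

lemma tsum_gaussTerm_eq_mul (hq1 : ‖q‖ < 1) (c t : ℂ) :
    ∑' M, gaussTerm q c t M = (1 - t) * ∑' M, gaussTerm q (c * q) (t * q) M := by
  set U : ℕ → ℂ := fun M => (1 - q ^ M) * gaussTerm q c t M with hU
  have hUs : Summable U := by
    refine Summable.of_norm_bounded ((summable_gaussTerm hq1 c t).norm.mul_left 2) fun M => ?_
    rw [hU, norm_mul]
    gcongr
    refine (norm_sub_le _ _).trans ?_
    rw [norm_one, norm_pow]
    linarith [pow_le_one₀ (n := M) (norm_nonneg q) hq1.le]
  have hstep (M : ℕ) :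
      gaussTerm q c t M - (1 - t) * gaussTerm q (c * q) (t * q) M = U M - U (M + 1) := by
    have hprod : ∏ j ∈ Finset.range M, q ^ j * (c * q * q ^ j - t * q) / (1 - q ^ (j + 1)) =
        q ^ M * ∏ j ∈ Finset.range M, q ^ j * (c * q ^ j - t) / (1 - q ^ (j + 1)) := by
      have hterm (j : ℕ) : q ^ j * (c * q * q ^ j - t * q) / (1 - q ^ (j + 1)) =
          q * (q ^ j * (c * q ^ j - t) / (1 - q ^ (j + 1))) := by ring
      simp_rw [hterm, Finset.prod_mul_distrib (f := fun _ => q), Finset.prod_const,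
        Finset.card_range]
    have hM := one_sub_pow_succ_ne_zero hq1 M
    have harg : c * q * q ^ M = c * q ^ (M + 1) := by ring
    have harg' : c * q ^ M * q = c * q ^ (M + 1) := by ring
    simp only [hU, gaussTerm, hprod, Finset.prod_range_succ, harg,
      qPochInf_eq_mul hq1 (c * q ^ M), harg']
    generalize ∏ j ∈ Finset.range M, q ^ j * (c * q ^ j - t) / (1 - q ^ (j + 1)) = D
    generalize qPochInf (c * q ^ (M + 1)) q = E
    field_simp
    ring
  have h1 := (summable_gaussTerm hq1 (c * q) (t * q)).mul_left (1 - t)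
  rw [← sub_eq_zero, ← tsum_mul_left, ← (summable_gaussTerm hq1 c t).tsum_sub h1]
  simp_rw [hstep]
  rw [hUs.tsum_sub ((summable_nat_add_iff 1).2 hUs), hUs.tsum_eq_zero_add]
  simp [hU]

/-- The confluent `q`-Gauss summation. -/
lemma tsum_gaussTerm (hq1 : ‖q‖ < 1) (c t : ℂ) : ∑' M, gaussTerm q c t M = qPochInf t q := by
  have hiter (n : ℕ) : ∑' M, gaussTerm q c t M =
      (∏ j ∈ Finset.range n, (1 - t * q ^ j)) *
        ∑' M, gaussTerm q (c * q ^ n) (t * q ^ n) M := by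
    induction n with
    | zero => simp
    | succ n ih =>
      rw [ih, tsum_gaussTerm_eq_mul hq1 (c * q ^ n), Finset.prod_range_succ]
      simp only [pow_succ, mul_assoc]
  have hpow (x : ℂ) (n : ℕ) : ‖x * q ^ n‖ ≤ ‖x‖ := by
    rw [norm_mul, norm_pow]
    exact mul_le_of_le_one_right (norm_nonneg _) (pow_le_one₀ (norm_nonneg _) hq1.le)
  have hq := tendsto_pow_atTop_nhds_zero_of_norm_lt_one hq1
  have hlim : Tendsto (fun n : ℕ => ∑' M, gaussTerm q (c * q ^ n) (t * q ^ n) M) atTop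
      (𝓝 (∑' M : ℕ, if M = 0 then 1 else 0)) := by
    refine tendsto_tsum_of_dominated_convergence
      ((gaussTerm_bound_summable hq1 (‖c‖ + ‖t‖)).mul_right (Real.exp (‖c‖ * (1 - ‖q‖)⁻¹)))
      (fun M => ?_)
      (Eventually.of_forall fun n M => norm_gaussTerm_le hq1 (hpow c n) (hpow t n) M)
    have hinf : Tendsto (fun n : ℕ => qPochInf (c * q ^ n * q ^ M) q) atTop (𝓝 1) := by
      simpa only [mul_right_comm] using tendsto_qPochInf_mul_pow hq1 (c * q ^ M)
    rcases M with _ | M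
    · simpa [gaussTerm] using hinf
    · have hprod : Tendsto (fun n : ℕ => ∏ j ∈ Finset.range (M + 1),
          q ^ j * (c * q ^ n * q ^ j - t * q ^ n) / (1 - q ^ (j + 1))) atTop
          (𝓝 (∏ j ∈ Finset.range (M + 1),
            q ^ j * (c * 0 * q ^ j - t * 0) / (1 - q ^ (j + 1)))) :=
        tendsto_finsetProd _ fun j _ => ((((hq.const_mul c).mul_const _).sub
          (hq.const_mul t)).const_mul _).div_const _
      simpa [gaussTerm] using hprod.mul hinf
  rw [tsum_ite_eq] at hlim
  have h := (multipliable_qPochInf hq1 t).hasProd.tendsto_prod_nat.mul hlim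
  rw [mul_one] at h
  exact tendsto_nhds_unique tendsto_const_nhds (h.congr fun n => (hiter n).symm)

end ConfluentGauss

section ReciprocalPochhammer

variable {q : ℂ}

lemma inv_qPochZ (x q : ℂ) (m : ℤ) :
    (qPochZ x q m)⁻¹ = qPochInf (x * q ^ m) q / qPochInf x q :=
  inv_div _ _

lemma inv_qPochZ_self_of_neg (hq : q ≠ 0) {m : ℤ} (hm : m < 0) : (qPochZ q q m)⁻¹ = 0 := by
  obtain ⟨l, rfl⟩ : ∃ l : ℕ, m = -(l + 1) := ⟨(-m - 1).toNat, by omega⟩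
  rw [inv_qPochZ, qPochInf_eq_zero l, zero_div]
  rw [zpow_neg, show ((l : ℤ) + 1) = ((l + 1 : ℕ) : ℤ) by push_cast; rfl, zpow_natCast]
  field_simp
  ring

lemma inv_qPochZ_self_natCast (hq1 : ‖q‖ < 1) (M : ℕ) :
    (qPochZ q q M)⁻¹ = (∏ j ∈ Finset.range M, (1 - q ^ (j + 1)))⁻¹ := by
  have h := prod_mul_qPochInf hq1 q M
  have h0 := qPochInf_self_ne_zero hq1
  have hP : ∏ j ∈ Finset.range M, (1 - q ^ (j + 1)) ≠ 0 :=
    Finset.prod_ne_zero_iff.2 fun j _ => one_sub_pow_succ_ne_zero hq1 j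
  simp only [← pow_succ'] at h
  rw [inv_qPochZ, zpow_natCast, ← pow_succ', div_eq_iff h0, ← h, inv_mul_cancel_left₀ hP]

lemma exists_norm_inv_qPochZ_self_le (hq : q ≠ 0) (hq1 : ‖q‖ < 1) :
    ∃ C : ℝ, 0 ≤ C ∧ ∀ m : ℤ, ‖(qPochZ q q m)⁻¹‖ ≤ C := by
  refine ⟨Real.exp (1 * (1 - ‖q‖)⁻¹) / ‖qPochInf q q‖, by positivity, fun m => ?_⟩
  rcases lt_or_ge m 0 with hm | hm
  · rw [inv_qPochZ_self_of_neg hq hm, norm_zero]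
    positivity
  · lift m to ℕ using hm
    rw [inv_qPochZ, norm_div, zpow_natCast, ← pow_succ']
    gcongr
    refine norm_qPochInf_le hq1 ?_
    rw [norm_pow]
    exact pow_le_one₀ (norm_nonneg _) hq1.le

lemma qPochZ_add_one (hq : q ≠ 0) (hq1 : ‖q‖ < 1) {x : ℂ} {n : ℤ}
    (hx : qPochInf (x * q ^ n) q ≠ 0) :
    qPochZ x q (n + 1) = qPochZ x q n * (1 - x * q ^ n) := by
  have h := qPochInf_eq_mul hq1 (x * q ^ n)
  rw [mul_assoc, ← zpow_add_one₀ hq] at h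
  have h1 : 1 - x * q ^ n ≠ 0 := fun h0 => hx (by rw [h, h0, zero_mul])
  have h2 : qPochInf (x * q ^ (n + 1)) q ≠ 0 := fun h0 => hx (by rw [h, h0, mul_zero])
  rw [qPochZ, qPochZ, h]
  field_simp

end ReciprocalPochhammer

section BaileyPair

variable {a q : ℂ}

/-- The weight `a ^ N * q ^ (N (N + 1) / 2) * (-1/a;q)_N`, in a form without division by `a`. -/
noncomputable def baileyWeight (a q : ℂ) (N : ℕ) : ℂ :=
  ∏ j ∈ Finset.range N, q ^ (j + 1) * (a + q ^ j)

lemma mul_qPochN_eq_baileyWeight (ha : a ≠ 0) (N : ℕ) :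
    a ^ N * q ^ (N * (N + 1) / 2) * qPochN (-(1 / a)) q N = baileyWeight a q N := by
  induction N with
  | zero => simp [qPochN, baileyWeight]
  | succ N ih =>
    have he : (N + 1) * (N + 1 + 1) / 2 = N * (N + 1) / 2 + (N + 1) := by
      rw [show (N + 1) * (N + 1 + 1) = N * (N + 1) + 2 * (N + 1) by ring,
        Nat.add_mul_div_left _ _ two_pos]
    rw [baileyWeight, Finset.prod_range_succ, ← baileyWeight, ← ih, he, qPochN, qPochN,
      Finset.prod_range_succ, pow_add q]
    generalize ∏ i ∈ Finset.range N, (1 - -(1 / a) * q ^ i) = P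
    field_simp
    ring

lemma summable_baileyWeight (hq1 : ‖q‖ < 1) (a : ℂ) : Summable (baileyWeight a q) := by
  have h := tendsto_pow_atTop_nhds_zero_of_norm_lt_one hq1
  refine summable_prod_range_of_tendsto_zero ?_
  simpa using ((tendsto_add_atTop_iff_nat 1).2 h).mul (h.const_add a)

/-- The conjugate Bailey pair attached to `baileyWeight`, at a natural number index. -/
lemma tsum_baileyWeight_mul_natCast (hq : q ≠ 0) (hq1 : ‖q‖ < 1) (n : ℕ) :
    ∑' N : ℕ, baileyWeight a q N * ((qPochZ q q ((N : ℤ) - n))⁻¹ * (qPochZ q q ((N : ℤ) + n))⁻¹) =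
      baileyWeight a q n * qPochInf (-(a * q) * q ^ n) q / qPochInf q q := by
  have hsupp : Function.support (fun N : ℕ => baileyWeight a q N *
      ((qPochZ q q ((N : ℤ) - n))⁻¹ * (qPochZ q q ((N : ℤ) + n))⁻¹)) ⊆
      Set.range fun M : ℕ => M + n := by
    intro N hN
    by_contra hrange
    have hlt : N < n := by
      by_contra! hle
      exact hrange ⟨N - n, Nat.sub_add_cancel hle⟩
    exact hN (by simp [inv_qPochZ_self_of_neg hq (show (N : ℤ) - n < 0 by omega)])
  rw [← (add_left_injective n).tsum_eq hsupp, ← tsum_gaussTerm hq1 (q ^ (2 * n + 1)),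
    mul_div_right_comm, ← tsum_mul_left]
  refine tsum_congr fun M => ?_
  have hw : baileyWeight a q (M + n) = baileyWeight a q n *
      ∏ j ∈ Finset.range M, q ^ j * (q ^ (2 * n + 1) * q ^ j - -(a * q) * q ^ n) := by
    rw [add_comm, baileyWeight, Finset.prod_range_add, baileyWeight]
    congr 1
    refine Finset.prod_congr rfl fun j _ => ?_
    ring
  have hs : ((M + n : ℕ) : ℤ) - n = M := by push_cast; ring
  have ha : ((M + n : ℕ) : ℤ) + n = (M + 2 * n : ℕ) := by push_cast; ring
  rw [hw, hs, ha, inv_qPochZ_self_natCast hq1, inv_qPochZ, zpow_natCast, gaussTerm,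
    Finset.prod_div_distrib, show q * q ^ (M + 2 * n) = q ^ (2 * n + 1) * q ^ M by ring]
  ring

/-- The value of the conjugate Bailey pair, up to the factor `(-aq;q)_∞ / (q;q)_∞`. -/
noncomputable def baileyDual (a q : ℂ) (n : ℤ) : ℂ :=
  a ^ n * q ^ (n * (n + 1) / 2) * (qPochZ (-(1 / a)) q n / qPochZ (-(a * q)) q n)

lemma baileyDual_add_one (ha : a ≠ 0) (hq : q ≠ 0) (hq1 : ‖q‖ < 1)
    (h₁ : ∀ m : ℤ, qPochInf (-(1 / a) * q ^ m) q ≠ 0)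
    (h₂ : ∀ m : ℤ, qPochInf (-(a * q) * q ^ m) q ≠ 0) (n : ℤ) :
    baileyDual a q (n + 1) * (1 + a * q ^ (n + 1)) =
      baileyDual a q n * (q ^ (n + 1) * (a + q ^ n)) := by
  have he : (n + 1) * (n + 1 + 1) / 2 = n * (n + 1) / 2 + (n + 1) := by
    rw [show (n + 1) * (n + 1 + 1) = n * (n + 1) + 2 * (n + 1) by ring,
      Int.add_mul_ediv_left _ _ two_ne_zero]
  have hfac : 1 - -(a * q) * q ^ n = 1 + a * (q ^ n * q) := by ring
  have hne : 1 + a * (q ^ n * q) ≠ 0 := fun h =>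
    h₂ n (qPochInf_eq_zero 0 (by rw [pow_zero, mul_one, hfac, h]))
  have hz : qPochZ (-(a * q)) q n ≠ 0 := div_ne_zero (by simpa using h₂ 0) (h₂ n)
  rw [baileyDual, baileyDual, qPochZ_add_one hq hq1 (h₁ n), qPochZ_add_one hq hq1 (h₂ n), he,
    zpow_add₀ hq (n * (n + 1) / 2), zpow_add_one₀ ha, zpow_add_one₀ hq n,
    hfac]
  generalize 1 + a * (q ^ n * q) = d at hne ⊢
  field_simp
  ring

lemma baileyDual_natCast_and_neg (ha : a ≠ 0) (hq : q ≠ 0) (hq1 : ‖q‖ < 1)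
    (h₁ : ∀ m : ℤ, qPochInf (-(1 / a) * q ^ m) q ≠ 0)
    (h₂ : ∀ m : ℤ, qPochInf (-(a * q) * q ^ m) q ≠ 0) (n : ℕ) :
    qPochInf (-(a * q)) q * baileyDual a q n =
        baileyWeight a q n * qPochInf (-(a * q) * q ^ n) q ∧
      qPochInf (-(a * q)) q * baileyDual a q (-n) =
        baileyWeight a q n * qPochInf (-(a * q) * q ^ n) q := by
  have h10 : qPochInf (-a⁻¹) q ≠ 0 := by simpa using h₁ 0
  have h20 : qPochInf (-(a * q)) q ≠ 0 := by simpa using h₂ 0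
  induction n with
  | zero => simp [baileyDual, baileyWeight, qPochZ, h10, h20]
  | succ n ih =>
    have hinf := qPochInf_eq_mul hq1 (-(a * q) * q ^ n)
    rw [mul_assoc _ _ q, ← pow_succ] at hinf
    have hne : 1 + a * q ^ (n + 1) ≠ 0 := fun h => h₂ n (qPochInf_eq_zero 0 (by
      rw [zpow_natCast, pow_zero, ← h]; ring))
    have hw : baileyWeight a q (n + 1) = baileyWeight a q n * (q ^ (n + 1) * (a + q ^ n)) :=
      Finset.prod_range_succ _ _
    have hpos := baileyDual_add_one ha hq hq1 h₁ h₂ n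
    have hneg := baileyDual_add_one ha hq hq1 h₁ h₂ (-((n + 1 : ℕ) : ℤ))
    rw [show -((n + 1 : ℕ) : ℤ) + 1 = -(n : ℤ) by push_cast; ring, zpow_neg, zpow_neg,
      zpow_natCast, zpow_natCast] at hneg
    have hneg' : baileyDual a q (-((n + 1 : ℕ) : ℤ)) * (1 + a * q ^ (n + 1)) =
        baileyDual a q (-n) * (q ^ (n + 1) * (a + q ^ n)) := by
      field_simp at hneg
      linear_combination -hneg
    rw [show (n : ℤ) + 1 = ((n + 1 : ℕ) : ℤ) by push_cast; rfl, zpow_natCast, zpow_natCast] at hpos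
    rw [hinf] at ih
    rw [hw]
    constructor
    · refine mul_right_cancel₀ hne ?_
      linear_combination qPochInf (-(a * q)) q * hpos + q ^ (n + 1) * (a + q ^ n) * ih.1
    · refine mul_right_cancel₀ hne ?_
      linear_combination qPochInf (-(a * q)) q * hneg' + q ^ (n + 1) * (a + q ^ n) * ih.2

lemma tsum_baileyWeight_mul (ha : a ≠ 0) (hq : q ≠ 0) (hq1 : ‖q‖ < 1)
    (h₁ : ∀ m : ℤ, qPochInf (-(1 / a) * q ^ m) q ≠ 0)
    (h₂ : ∀ m : ℤ, qPochInf (-(a * q) * q ^ m) q ≠ 0) (n : ℤ) :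
    ∑' N : ℕ, baileyWeight a q N * ((qPochZ q q ((N : ℤ) - n))⁻¹ * (qPochZ q q ((N : ℤ) + n))⁻¹) =
      qPochInf (-(a * q)) q / qPochInf q q * baileyDual a q n := by
  obtain ⟨m, rfl | rfl⟩ := n.eq_nat_or_neg
  · rw [tsum_baileyWeight_mul_natCast hq hq1,
      ← (baileyDual_natCast_and_neg ha hq hq1 h₁ h₂ m).1]
    ring
  · simp only [sub_neg_eq_add, ← sub_eq_add_neg]
    simp_rw [mul_comm (qPochZ q q (_ + _))⁻¹]
    rw [tsum_baileyWeight_mul_natCast hq hq1,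
      ← (baileyDual_natCast_and_neg ha hq hq1 h₁ h₂ m).2]
    ring

/-- Summability of a sequence on `ℤ` dominated by `‖q‖` to a power growing at least linearly. -/
lemma summable_neg_one_zpow_mul_zpow (hq : q ≠ 0) (hq1 : ‖q‖ < 1) {e : ℤ → ℤ}
    (he : ∀ n, |n| - 1 ≤ e n) : Summable fun n : ℤ => (-1 : ℂ) ^ n * q ^ e n := by
  have hq0 : 0 < ‖q‖ := norm_pos_iff.2 hq
  have hnat : Summable fun n : ℕ => ‖q‖ ^ ((n : ℤ) - 1) := by
    simp_rw [zpow_sub_one₀ hq0.ne', zpow_natCast]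
    exact (summable_geometric_of_lt_one hq0.le hq1).mul_right _
  have hint : Summable fun n : ℤ => ‖q‖ ^ (|n| - 1) :=
    Summable.of_nat_of_neg (by simpa using hnat) (by simpa using hnat)
  refine Summable.of_norm_bounded hint fun n => ?_
  rw [norm_mul, norm_zpow, norm_zpow, norm_neg, norm_one, one_zpow, one_mul]
  exact zpow_le_zpow_right_of_le_one₀ hq0 hq1.le (he n)

end BaileyPair

lemma abs_sub_one_le_exponent {k i : ℕ} (hi : 1 ≤ i) (hik : i ≤ k) (n : ℤ) :
    |n| - 1 ≤ (k : ℤ) * n ^ 2 + n * ((k : ℤ) - (i : ℤ)) - n * (n - 1) / 2 := by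
  have h2 : 2 * (n * (n - 1) / 2) = n * (n - 1) := by
    refine Int.mul_ediv_cancel' ?_
    simpa [mul_comm] using (Int.even_mul_succ_self (n - 1)).two_dvd
  have hi' : (1 : ℤ) ≤ i := by exact_mod_cast hi
  have hik' : (i : ℤ) ≤ k := by exact_mod_cast hik
  suffices h : 2 * (|n| - 1) ≤
      2 * ((k : ℤ) * n ^ 2 + n * ((k : ℤ) - (i : ℤ))) - n * (n - 1) by omega
  obtain ⟨m, rfl | rfl⟩ := n.eq_nat_or_neg
  · have hm : (0 : ℤ) ≤ m := m.cast_nonneg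
    rw [abs_of_nonneg hm]
    nlinarith [mul_nonneg hm (sub_nonneg.2 hik'),
      mul_nonneg (sq_nonneg (m : ℤ)) (sub_nonneg.2 (hi'.trans hik')), sq_nonneg ((m : ℤ) - 1)]
  · have hm : (0 : ℤ) ≤ m := m.cast_nonneg
    have hmm : (0 : ℤ) ≤ m * (m - 1) := by
      rcases m with _ | m
      · simp
      · push_cast; nlinarith
    have hmm' : (0 : ℤ) ≤ (m - 1) * (m - 2) := by
      rcases m with _ | _ | m
      · simp
      · simp
      · push_cast; nlinarith
    rw [abs_neg, abs_of_nonneg hm]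
    nlinarith [mul_nonneg hm (sub_nonneg.2 hi'),
      mul_nonneg hmm (sub_nonneg.2 (hi'.trans hik'))]

/-- Summing the closed form of Theorem 3.2 over `N` gives equation (1.2) of
Theorem 1.5. -/
theorem sum_closed_form (k i : ℕ) (hi : 1 ≤ i) (hik : i ≤ k) (a q : ℂ)
    (hq0 : 0 < ‖q‖) (hq1 : ‖q‖ < 1) (ha : a ≠ 0)
    (hpoch : ∀ m : ℤ, qPochZ (-(a * q)) q m ≠ 0) :
    ∑' N : ℕ, a ^ N * q ^ (N * (N + 1) / 2) * qPochN (-(1 / a)) q N *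
        ∑ n ∈ Finset.Icc (-(N : ℤ)) (N : ℤ), (-1 : ℂ) ^ n *
          q ^ ((k : ℤ) * n ^ 2 + n * ((k : ℤ) - (i : ℤ)) - n * (n - 1) / 2) /
            (qPochZ q q ((N : ℤ) - n) * qPochZ q q ((N : ℤ) + n)) =
      qPochInf (-(a * q)) q / qPochInf q q *
        ∑' n : ℤ, (-1 : ℂ) ^ n * a ^ n *
          q ^ ((k : ℤ) * n ^ 2 + ((k : ℤ) - (i : ℤ) + 1) * n) *
          (qPochZ (-(1 / a)) q n / qPochZ (-(a * q)) q n) := by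
  have hq : q ≠ 0 := norm_pos_iff.1 hq0
  have h₂ (m : ℤ) : qPochInf (-(a * q) * q ^ m) q ≠ 0 := fun h =>
    hpoch m (by rw [qPochZ, h, div_zero])
  have h₁ (m : ℤ) : qPochInf (-(1 / a) * q ^ m) q ≠ 0 := by
    refine qPochInf_ne_zero hq1 fun j h => h₂ (-(m + j) - 1) (qPochInf_eq_zero 0 ?_)
    rw [mul_assoc, ← zpow_natCast, ← zpow_add₀ hq] at h
    have hz : q ^ (m + j) ≠ 0 := zpow_ne_zero _ hq
    rw [zpow_sub_one₀ hq, zpow_neg, pow_zero]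
    field_simp at h ⊢
    linear_combination h
  set α : ℤ → ℂ := fun n => (-1 : ℂ) ^ n *
    q ^ ((k : ℤ) * n ^ 2 + n * ((k : ℤ) - (i : ℤ)) - n * (n - 1) / 2) with hα
  have hαs : Summable α := summable_neg_one_zpow_mul_zpow hq hq1 (abs_sub_one_le_exponent hi hik)
  set F : ℕ → ℤ → ℂ := fun N n => baileyWeight a q N *
    ((qPochZ q q ((N : ℤ) - n))⁻¹ * (qPochZ q q ((N : ℤ) + n))⁻¹) * α n with hF
  have hFs : Summable (Function.uncurry F) := by
    obtain ⟨C, hC0, hC⟩ := exists_norm_inv_qPochZ_self_le hq hq1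
    refine Summable.of_norm_bounded
      (((summable_baileyWeight hq1 a).norm.mul_of_nonneg hαs.norm (fun _ => norm_nonneg _)
        fun _ => norm_nonneg _).mul_left (C * C)) fun p => ?_
    simp only [Function.uncurry, hF, norm_mul]
    have h := mul_le_mul (hC ((p.1 : ℤ) - p.2)) (hC ((p.1 : ℤ) + p.2)) (norm_nonneg _) hC0
    nlinarith [mul_le_mul_of_nonneg_left h
      (mul_nonneg (norm_nonneg (baileyWeight a q p.1)) (norm_nonneg (α p.2)))]
  have hleft (N : ℕ) : a ^ N * q ^ (N * (N + 1) / 2) * qPochN (-(1 / a)) q N *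
      ∑ n ∈ Finset.Icc (-(N : ℤ)) (N : ℤ), (-1 : ℂ) ^ n *
        q ^ ((k : ℤ) * n ^ 2 + n * ((k : ℤ) - (i : ℤ)) - n * (n - 1) / 2) /
          (qPochZ q q ((N : ℤ) - n) * qPochZ q q ((N : ℤ) + n)) = ∑' n : ℤ, F N n := by
    rw [mul_qPochN_eq_baileyWeight ha, tsum_eq_sum (s := Finset.Icc (-(N : ℤ)) (N : ℤ)),
      Finset.mul_sum]
    · refine Finset.sum_congr rfl fun n _ => ?_
      rw [hF, div_eq_mul_inv, mul_inv]
      ring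
    · intro n hn
      rw [Finset.mem_Icc, not_and_or] at hn
      rcases hn with hn | hn
      · simp [hF, inv_qPochZ_self_of_neg hq (show (N : ℤ) + n < 0 by omega)]
      · simp [hF, inv_qPochZ_self_of_neg hq (show (N : ℤ) - n < 0 by omega)]
  rw [tsum_congr hleft, ← hFs.tsum_comm, ← tsum_mul_left]
  refine tsum_congr fun n => ?_
  rw [hF, tsum_mul_right, tsum_baileyWeight_mul ha hq hq1 h₁ h₂, baileyDual, hα]
  have he : (k : ℤ) * n ^ 2 + ((k : ℤ) - (i : ℤ) + 1) * n = n * (n + 1) / 2 +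
      ((k : ℤ) * n ^ 2 + n * ((k : ℤ) - (i : ℤ)) - n * (n - 1) / 2) := by
    rw [show n * (n + 1) = n * (n - 1) + 2 * n by ring, Int.add_mul_ediv_left _ _ two_ne_zero]
    ring
  rw [he, zpow_add₀ hq (n * (n + 1) / 2)]
  ring

end Paper
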